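/- The limit lim_{z → 0⁻} ℓ_f(z) exists and is finite if and only if 2n_o + d ≥ 5. Moreover, writing ℓ_f(0) for this limit when it exists, the limit lim_{z → 0⁻} (ℓ_f(z) − ℓ_f(0))/z exists and is finite if and only if 2n_o + d ≥ 9, in which case it equals ∫_{𝕋^d} f(q)/𝔢(q)² dq. -/

import Mathlib

open MeasureTheory Filter Topology

noncomputable section

/-- The cube (-π, π]^d, a fundamental domain representing the torus 𝕋^d. -/
def torusCube (d : ℕ) : Set (Fin d → ℝ) := Set.univ.pi fun _ => Set.Ioc (-Real.pi) Real.pi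

/-- Lebesgue (Haar) measure on the torus 𝕋^d, realized on the fundamental domain. -/
def torusMeasure (d : ℕ) : Measure (Fin d → ℝ) := volume.restrict (torusCube d)

/-- The dispersion relation 𝔢(q) = (∑ᵢ (1 - cos qᵢ))² of the discrete bilaplacian. -/
def disp (d : ℕ) (q : Fin d → ℝ) : ℝ := (∑ i, (1 - Real.cos (q i))) ^ 2

/-- The integral ℓ_f(z) = ∫_{𝕋^d} f(q)/(𝔢(q) − z) dq. -/
def ellInt (d : ℕ) (f : (Fin d → ℝ) → ℝ) (z : ℝ) : ℝ :=
  ∫ q, f q / (disp d q - z) ∂(torusMeasure d)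

/-- The homogeneous leading term of an analytic function at the origin. -/
theorem exists_leading_term {E : Type*} [NormedAddCommGroup E] [NormedSpace ℝ E]
    {f : E → ℝ} (hf : AnalyticAt ℝ f 0) {n : ℕ}
    (hzero : ∀ j < n, iteratedFDeriv ℝ j f 0 = 0) (hne : iteratedFDeriv ℝ n f 0 ≠ 0) :
    ∃ P : ContinuousMultilinearMap ℝ (fun _ : Fin n => E) ℝ,
      (∃ v, P (fun _ => v) ≠ 0) ∧
      (fun y => f y - P (fun _ => y)) =O[𝓝 0] fun y => ‖y‖ ^ (n + 1) := by
  obtain ⟨p, r, hp⟩ := hf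
  refine ⟨p n, ?_, ?_⟩
  · by_contra! hv
    apply hne
    let q : FormalMultilinearSeries ℝ E ℝ := fun k => if k = n then 0 else p k
    have hq : HasFPowerSeriesOnBall f q 0 r := by
      refine ⟨hp.r_le.trans (FormalMultilinearSeries.radius_le_of_le fun k => ?_), hp.r_pos,
        fun {y} hy => ?_⟩
      · by_cases hk : k = n <;> simp [q, hk]
      · convert hp.hasSum hy using 2 with k
        by_cases hk : k = n
        · subst hk
          simp [q, hv]
        · simp [q, hk]
    ext v
    rw [hq.iteratedFDeriv_eq_sum_of_completeSpace]
    simp [q]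
  · have h := hp.hasFPowerSeriesAt.isBigO_sub_partialSum_pow (n + 1)
    refine h.congr_left fun y => ?_
    have hlow : ∀ k ∈ Finset.range n, p k (fun _ => y) = 0 := by
      intro k hk
      have := hp.factorial_smul y k
      rw [hzero k (Finset.mem_range.1 hk)] at this
      simpa [k.factorial_ne_zero] using this
    simp [FormalMultilinearSeries.partialSum, Finset.sum_range_succ, Finset.sum_eq_zero hlow]

/-- For nonnegative `u` and `e` with `u / e` integrable and `e ≠ 0` almost everywhere, the
integrals of `u / (e - z)` converge to the integral of `u / e` as `z ↑ 0`. -/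
theorem tendsto_integral_div_sub {α : Type*} [MeasurableSpace α] {μ : Measure α} {u e : α → ℝ}
    (hu : Measurable u) (he : Measurable e) (hu0 : ∀ x, 0 ≤ u x) (he0 : ∀ x, 0 ≤ e x)
    (hpos : ∀ᵐ x ∂μ, e x ≠ 0) (hint : Integrable (fun x => u x / e x) μ) :
    Tendsto (fun z => ∫ x, u x / (e x - z) ∂μ) (𝓝[<] 0) (𝓝 (∫ x, u x / e x ∂μ)) := by
  refine tendsto_integral_filter_of_dominated_convergence (fun x => u x / e x) ?_ ?_ hint ?_
  · exact Eventually.of_forall fun z => (hu.div (he.sub_const z)).aestronglyMeasurable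
  · filter_upwards [self_mem_nhdsWithin] with z hz
    filter_upwards [hpos] with x hx
    have hx' : 0 < e x := lt_of_le_of_ne (he0 x) hx.symm
    have hz' : z < 0 := hz
    rw [Real.norm_of_nonneg (div_nonneg (hu0 x) (by linarith))]
    exact div_le_div_of_nonneg_left (hu0 x) hx' (by linarith)
  · filter_upwards [hpos] with x hx
    have : Tendsto (fun z : ℝ => u x / (e x - z)) (𝓝 0) (𝓝 (u x / (e x - 0))) :=
      Tendsto.div tendsto_const_nhds (tendsto_const_nhds.sub tendsto_id) (by simpa using hx)
    simpa using this.mono_left nhdsWithin_le_nhds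

/-- If the integrals of `u / (e - z)`, with `u` and `e` nonnegative, have a finite limit as
`z ↑ 0`, then `u / e` is integrable. -/
theorem integrable_div_of_tendsto {α : Type*} [MeasurableSpace α] {μ : Measure α} {u e : α → ℝ}
    (hu : Measurable u) (he : Measurable e) (hu0 : ∀ x, 0 ≤ u x) (he0 : ∀ x, 0 ≤ e x)
    (hpos : ∀ᵐ x ∂μ, e x ≠ 0) (hint : Integrable u μ) {L : ℝ}
    (hL : Tendsto (fun z => ∫ x, u x / (e x - z) ∂μ) (𝓝[<] 0) (𝓝 L)) :
    Integrable (fun x => u x / e x) μ := by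
  have hnn : ∀ z < 0, ∀ x, 0 ≤ u x / (e x - z) := fun z hz x =>
    div_nonneg (hu0 x) (by linarith [he0 x])
  have hintz : ∀ z < 0, Integrable (fun x => u x / (e x - z)) μ := fun z hz => by
    refine (hint.div_const (-z)).mono' (hu.div (he.sub_const z)).aestronglyMeasurable
      (Eventually.of_forall fun x => ?_)
    rw [Real.norm_of_nonneg (hnn z hz x)]
    exact div_le_div_of_nonneg_left (hu0 x) (by linarith) (by linarith [he0 x])
  have hfatou : ∫⁻ x, ENNReal.ofReal (u x / e x) ∂μ ≤ ENNReal.ofReal L := by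
    calc ∫⁻ x, ENNReal.ofReal (u x / e x) ∂μ
        = ∫⁻ x, liminf (fun z => ENNReal.ofReal (u x / (e x - z))) (𝓝[<] 0) ∂μ := by
          refine lintegral_congr_ae ?_
          filter_upwards [hpos] with x hx
          have : Tendsto (fun z : ℝ => u x / (e x - z)) (𝓝 0) (𝓝 (u x / (e x - 0))) :=
            Tendsto.div tendsto_const_nhds (tendsto_const_nhds.sub tendsto_id) (by simpa using hx)
          rw [sub_zero] at this
          exact ((ENNReal.tendsto_ofReal this).mono_left nhdsWithin_le_nhds).liminf_eq.symm
      _ ≤ liminf (fun z => ∫⁻ x, ENNReal.ofReal (u x / (e x - z)) ∂μ) (𝓝[<] 0) :=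
          lintegral_liminf_le fun z => (hu.div (he.sub_const z)).ennreal_ofReal
      _ = ENNReal.ofReal L := by
          refine (Tendsto.congr' ?_ (ENNReal.tendsto_ofReal hL)).liminf_eq
          filter_upwards [self_mem_nhdsWithin] with z hz
          exact ofReal_integral_eq_lintegral_ofReal (hintz z hz) (Eventually.of_forall (hnn z hz))
  refine ⟨(hu.div he).aestronglyMeasurable, ?_⟩
  rw [hasFiniteIntegral_iff_ofReal (Eventually.of_forall fun x => div_nonneg (hu0 x) (he0 x))]
  exact hfatou.trans_lt ENNReal.ofReal_lt_top

theorem continuous_disp (d : ℕ) : Continuous (disp d) := by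
  unfold disp
  fun_prop

theorem disp_nonneg (d : ℕ) (q : Fin d → ℝ) : 0 ≤ disp d q := sq_nonneg _

theorem disp_le (d : ℕ) (q : Fin d → ℝ) : disp d q ≤ (d * ‖q‖ ^ 2) ^ 2 := by
  have h : ∀ i, 1 - Real.cos (q i) ≤ ‖q‖ ^ 2 := fun i => by
    have h1 := Real.one_sub_sq_div_two_le_cos (x := q i)
    have h2 : q i ^ 2 ≤ ‖q‖ ^ 2 := by
      rw [← sq_abs]
      exact pow_le_pow_left₀ (abs_nonneg _) (norm_le_pi_norm q i) 2
    nlinarith [sq_nonneg (q i)]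
  refine pow_le_pow_left₀ (Finset.sum_nonneg fun i _ => by linarith [Real.cos_le_one (q i)]) ?_ 2
  simpa using Finset.sum_le_sum fun i (_ : i ∈ Finset.univ) => h i

theorem le_disp {d : ℕ} {q : Fin d → ℝ} (hq : ‖q‖ ≤ Real.pi) :
    (2 / Real.pi ^ 2 * ‖q‖ ^ 2) ^ 2 ≤ disp d q := by
  rcases isEmpty_or_nonempty (Fin d) with hd | hd
  · simp [disp, Subsingleton.elim q 0]
  obtain ⟨i, hi⟩ := Finite.exists_max fun i => ‖q i‖
  have hqi : ‖q‖ ≤ ‖q i‖ := (pi_norm_le_iff_of_nonneg (norm_nonneg _)).2 hi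
  have h1 := Real.cos_le_one_sub_mul_cos_sq ((norm_le_pi_norm q i).trans hq)
  have h2 : ‖q‖ ^ 2 ≤ q i ^ 2 := by
    rw [← sq_abs (q i)]
    exact pow_le_pow_left₀ (norm_nonneg _) hqi 2
  have h3 : 1 - Real.cos (q i) ≤ ∑ i, (1 - Real.cos (q i)) :=
    Finset.single_le_sum (f := fun i => 1 - Real.cos (q i))
      (fun i _ => by linarith [Real.cos_le_one (q i)]) (Finset.mem_univ i)
  refine pow_le_pow_left₀ (by positivity) (le_trans ?_ h3) 2
  have := mul_le_mul_of_nonneg_left h2 (show 0 ≤ 2 / Real.pi ^ 2 by positivity)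
  linarith

theorem disp_pos {d : ℕ} {q : Fin d → ℝ} (hq : ‖q‖ ≤ Real.pi) (hq0 : q ≠ 0) : 0 < disp d q := by
  have := norm_pos_iff.2 hq0
  exact lt_of_lt_of_le (by positivity) (le_disp hq)

theorem norm_le_of_mem_torusCube {d : ℕ} {q : Fin d → ℝ} (hq : q ∈ torusCube d) :
    ‖q‖ ≤ Real.pi :=
  (pi_norm_le_iff_of_nonneg Real.pi_pos.le).2 fun i =>
    abs_le.2 ⟨(hq i trivial).1.le, (hq i trivial).2⟩

theorem measurableSet_torusCube (d : ℕ) : MeasurableSet (torusCube d) :=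
  MeasurableSet.univ_pi fun _ => measurableSet_Ioc

theorem ball_subset_torusCube (d : ℕ) : Metric.ball (0 : Fin d → ℝ) Real.pi ⊆ torusCube d := by
  intro q hq i _
  have h := (norm_le_pi_norm q i).trans_lt (mem_ball_zero_iff.1 hq)
  exact ⟨(abs_lt.1 h).1, (abs_lt.1 h).2.le⟩

instance (d : ℕ) : IsFiniteMeasure (torusMeasure d) := by
  refine ⟨?_⟩
  rw [torusMeasure, Measure.restrict_apply_univ]
  have hsub : torusCube d ⊆ Metric.closedBall 0 Real.pi := fun q hq =>
    mem_closedBall_zero_iff.2 (norm_le_of_mem_torusCube hq)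
  exact (measure_mono hsub).trans_lt measure_closedBall_lt_top

theorem ae_disp_ne_zero {d : ℕ} (hd : 1 ≤ d) : ∀ᵐ q ∂(torusMeasure d), disp d q ≠ 0 := by
  have : Nonempty (Fin d) := ⟨⟨0, hd⟩⟩
  have h0 : ∀ᵐ q ∂(volume : Measure (Fin d → ℝ)), q ≠ 0 := by
    simp [ae_iff]
  filter_upwards [ae_restrict_of_ae h0, ae_restrict_mem (measurableSet_torusCube d)] with q hq hq'
  exact (disp_pos (norm_le_of_mem_torusCube hq') hq).ne'

theorem integrable_of_continuous {d : ℕ} {f : (Fin d → ℝ) → ℝ} (hf : Continuous f) :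
    Integrable f (torusMeasure d) := by
  have h := hf.continuousOn.integrableOn_compact (μ := volume)
    (isCompact_closedBall (0 : Fin d → ℝ) Real.pi)
  exact h.mono_set fun q hq => mem_closedBall_zero_iff.2 (norm_le_of_mem_torusCube hq)

/-- A function vanishing to order `n` at the origin, divided by the `m`-th power of the
dispersion relation, is integrable if `4 m < n + d`. -/
theorem integrable_div_disp_pow {d : ℕ} (hd : 1 ≤ d) {f : (Fin d → ℝ) → ℝ} (hf : Continuous f)
    {n m : ℕ} (hO : f =O[𝓝 0] fun y => ‖y‖ ^ n) (hnm : 4 * m < n + d) :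
    Integrable (fun q => f q / disp d q ^ m) (torusMeasure d) := by
  have : Nonempty (Fin d) := ⟨⟨0, hd⟩⟩
  obtain ⟨C, hC0, hC⟩ : ∃ C : ℝ, 0 ≤ C ∧ ∀ q : Fin d → ℝ, ‖q‖ ≤ Real.pi →
      |f q| ≤ C * ‖q‖ ^ n := by
    obtain ⟨C₁, hC₁⟩ := hO.bound
    obtain ⟨ε, hε, hball⟩ := Metric.eventually_nhds_iff_ball.1 hC₁
    obtain ⟨C₂, hC₂⟩ := (isCompact_closedBall (0 : Fin d → ℝ) Real.pi).exists_bound_of_continuousOn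
      hf.continuousOn
    refine ⟨max 0 (max C₁ (C₂ / ε ^ n)), le_max_left _ _, fun q hq => ?_⟩
    by_cases hqε : ‖q‖ < ε
    · have := hball q (mem_ball_zero_iff.2 hqε)
      simp only [Real.norm_eq_abs, abs_pow, abs_norm] at this
      refine this.trans ?_
      gcongr
      exact (le_max_left _ _).trans (le_max_right _ _)
    · have h1 : |f q| ≤ C₂ := hC₂ q (mem_closedBall_zero_iff.2 hq)
      have h2 : 0 ≤ C₂ := (abs_nonneg _).trans h1
      calc |f q| ≤ C₂ / ε ^ n * ε ^ n := by rwa [div_mul_cancel₀ _ (by positivity)]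
        _ ≤ C₂ / ε ^ n * ‖q‖ ^ n := by gcongr; exact not_lt.1 hqε
        _ ≤ _ := by
          gcongr
          exact (le_max_right _ _).trans (le_max_right _ _)
  have hnorm : IntegrableOn (fun q : Fin d → ℝ => ‖q‖ ^ ((n : ℝ) - 4 * m))
      (Metric.ball 0 4) volume := by
    rw [integrableOn_fun_norm_addHaar volume (f := fun y : ℝ => y ^ ((n : ℝ) - 4 * m))]
    have hs : -1 < ((d - 1 : ℕ) : ℝ) + ((n : ℝ) - 4 * m) := by
      have : (4 * m : ℝ) + 1 ≤ n + d := by exact_mod_cast hnm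
      push_cast [Nat.cast_sub hd]
      linarith
    refine ((intervalIntegral.integrableOn_Ioo_rpow_iff (by norm_num : (0 : ℝ) < 4)).2 hs).congr_fun
      (fun y hy => ?_) measurableSet_Ioo
    simp [Real.rpow_add hy.1]
  have hnorm' : Integrable (fun q : Fin d → ℝ => ‖q‖ ^ ((n : ℝ) - 4 * m)) (torusMeasure d) :=
    hnorm.mono_set fun q hq => mem_ball_zero_iff.2
      ((norm_le_of_mem_torusCube hq).trans_lt Real.pi_lt_four)
  refine (hnorm'.const_mul (C / ((2 / Real.pi ^ 2) ^ 2) ^ m)).mono'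
    (hf.measurable.div ((continuous_disp d).measurable.pow_const m)).aestronglyMeasurable ?_
  have h0 : ∀ᵐ q ∂(volume : Measure (Fin d → ℝ)), q ≠ 0 := by
    simp [ae_iff]
  filter_upwards [ae_restrict_of_ae h0, ae_restrict_mem (measurableSet_torusCube d)] with q hq hq'
  have hqπ := norm_le_of_mem_torusCube hq'
  have hqpos := norm_pos_iff.2 hq
  rw [norm_div, norm_pow, Real.norm_of_nonneg (disp_nonneg d q), Real.norm_eq_abs]
  calc |f q| / disp d q ^ m
      ≤ C * ‖q‖ ^ n / ((2 / Real.pi ^ 2 * ‖q‖ ^ 2) ^ 2) ^ m := by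
        gcongr
        · exact hC q hqπ
        · exact le_disp hqπ
    _ = _ := by
        rw [Real.rpow_sub hqpos, Real.rpow_natCast]
        have : ‖q‖ ^ (4 * m : ℝ) = ‖q‖ ^ (4 * m) := by
          rw [← Real.rpow_natCast]; push_cast; rfl
        rw [this, mul_pow, mul_pow, pow_mul ‖q‖ 4 m, ← pow_mul ‖q‖ 2 2, div_mul_div_comm]

/-- A nonnegative function whose leading term at the origin has degree `n`, divided by the `m`-th
power of the dispersion relation, is integrable only if `4 m < n + d`. -/
theorem lt_of_integrable_div_disp_pow {d : ℕ} (hd : 1 ≤ d) {f : (Fin d → ℝ) → ℝ}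
    (hf0 : ∀ q, 0 ≤ f q) {n m : ℕ} {P : ContinuousMultilinearMap ℝ (fun _ : Fin n => Fin d → ℝ) ℝ}
    (hP : ∃ v, P (fun _ => v) ≠ 0)
    (hO : (fun y => f y - P (fun _ => y)) =O[𝓝 0] fun y => ‖y‖ ^ (n + 1))
    (hint : Integrable (fun q => f q / disp d q ^ m) (torusMeasure d)) : 4 * m < n + d := by
  have : Nonempty (Fin d) := ⟨⟨0, hd⟩⟩
  by_contra! hnm
  have hPc : Continuous fun y => P (fun _ => y) := P.cont.comp (by fun_prop)
  obtain ⟨v, hv, hv0⟩ := (dense_compl_singleton (0 : Fin d → ℝ)).inter_open_nonempty _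
    (isOpen_ne.preimage hPc) hP
  have hv0' : 0 < ‖v‖ := norm_pos_iff.2 hv0
  have hPv : 0 < |P fun _ => v| := abs_pos.2 hv
  set δ := |P fun _ => v| / 2 with hδ
  have hδ0 : 0 < δ := by positivity
  obtain ⟨r₀, hr₀, hball⟩ := Metric.eventually_nhds_iff_ball.1
    (hPc.abs.continuousAt.eventually_const_lt (show δ < |P fun _ => v| by linarith))
  obtain ⟨r, hr, hrr₀, hrv⟩ : ∃ r, 0 < r ∧ r ≤ r₀ ∧ r ≤ ‖v‖ :=
    ⟨min r₀ ‖v‖, lt_min hr₀ hv0', min_le_left _ _, min_le_right _ _⟩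
  set R := 2 * ‖v‖ with hR
  have hR0 : 0 < R := by positivity
  have hvR : ∀ x ∈ Metric.ball v r, ‖x‖ < R ∧ x ≠ 0 := by
    intro x hx
    rw [mem_ball_iff_norm] at hx
    refine ⟨?_, ?_⟩
    · have := norm_add_le (x - v) v
      rw [sub_add_cancel] at this
      linarith
    · rintro rfl
      rw [zero_sub, norm_neg] at hx
      linarith
  obtain ⟨C, hC, hCO⟩ := hO.exists_pos
  obtain ⟨η, hη, hηball⟩ := Metric.eventually_nhds_iff_ball.1 hCO.bound
  set c := δ / 2 / (d * R ^ 2) ^ (2 * m) with hc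
  have hd0 : (0 : ℝ) < d := by exact_mod_cast hd
  have hc0 : 0 < c := by positivity
  -- the lower bound on the dilates of the ball around `v`
  have hsmall : ∀ᶠ ε in 𝓝[>] (0 : ℝ), ε ≤ 1 ∧ ε * R < η ∧ ε * R < Real.pi ∧
      ε * (C * R ^ (n + 1)) < δ / 2 := by
    have key : ∀ a b : ℝ, 0 < b → ∀ᶠ ε in 𝓝[>] (0 : ℝ), ε * a < b := by
      intro a b hb
      have : Tendsto (fun ε : ℝ => ε * a) (𝓝 0) (𝓝 (0 * a)) := tendsto_id.mul_const a
      rw [zero_mul] at this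
      exact (this.eventually_lt_const hb).filter_mono nhdsWithin_le_nhds
    filter_upwards [key 1 1 one_pos, key R η hη, key R _ Real.pi_pos,
      key (C * R ^ (n + 1)) (δ / 2) (by positivity)] with ε h1 h2 h3 h4
    exact ⟨by linarith, h2, h3, h4⟩
  set V := (volume : Measure (Fin d → ℝ)).real (Metric.ball 0 r) with hV
  have hV0 : 0 < V := ENNReal.toReal_pos (Metric.measure_ball_pos _ _ hr).ne'
    measure_ball_lt_top.ne
  have hvol : ∀ ε > 0, (volume : Measure (Fin d → ℝ)) (Metric.ball (ε • v) (ε * r)) =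
      ENNReal.ofReal (ε ^ d) * volume (Metric.ball (0 : Fin d → ℝ) r) := by
    intro ε hε
    rw [Measure.addHaar_ball_mul_of_pos _ _ hε]
    simp
  have hlower : ∀ᶠ ε in 𝓝[>] (0 : ℝ),
      c * V ≤ ∫ q in Metric.ball (ε • v) (ε * r), f q / disp d q ^ m ∂(torusMeasure d) := by
    filter_upwards [hsmall, self_mem_nhdsWithin] with ε ⟨hε1, hεη, hεπ, hεδ⟩ hε
    have hε : 0 < ε := hε
    have hmem : ∀ q ∈ Metric.ball (ε • v) (ε * r), ∃ x ∈ Metric.ball v r, q = ε • x := by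
      intro q hq
      refine ⟨ε⁻¹ • q, ?_, by rw [smul_inv_smul₀ hε.ne']⟩
      rw [mem_ball_iff_norm] at hq ⊢
      have : ε⁻¹ • q - v = ε⁻¹ • (q - ε • v) := by rw [smul_sub, inv_smul_smul₀ hε.ne']
      rw [this, norm_smul, norm_inv, Real.norm_of_nonneg hε.le, inv_mul_lt_iff₀ hε]
      exact hq
    have hnq : ∀ x ∈ Metric.ball v r, ‖ε • x‖ ≤ ε * R := fun x hx => by
      rw [norm_smul, Real.norm_of_nonneg hε.le]
      exact mul_le_mul_of_nonneg_left (hvR x hx).1.le hε.le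
    have hsub : Metric.ball (ε • v) (ε * r) ⊆ torusCube d := by
      intro q hq
      obtain ⟨x, hx, rfl⟩ := hmem q hq
      exact ball_subset_torusCube d (mem_ball_zero_iff.2 ((hnq x hx).trans_lt hεπ))
    have hbound : ∀ q ∈ Metric.ball (ε • v) (ε * r),
        c * (ε ^ n / ε ^ (4 * m)) ≤ f q / disp d q ^ m := by
      intro q hq
      obtain ⟨x, hx, rfl⟩ := hmem q hq
      have hx' := hnq x hx
      have hpos : 0 < disp d (ε • x) :=
        disp_pos (hx'.trans hεπ.le) (smul_ne_zero hε.ne' (hvR x hx).2)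
      have hdisp : disp d (ε • x) ^ m ≤ (d * R ^ 2) ^ (2 * m) * ε ^ (4 * m) := by
        calc disp d (ε • x) ^ m ≤ ((d * ‖ε • x‖ ^ 2) ^ 2) ^ m := by
              gcongr
              exact disp_le d _
          _ ≤ ((d * (ε * R) ^ 2) ^ 2) ^ m := by gcongr
          _ = _ := by
            rw [pow_mul _ 2 m, pow_mul ε 4 m, ← mul_pow]
            congr 1
            ring
      have hf : δ / 2 * ε ^ n ≤ f (ε • x) := by
        have h1 := hηball _ (mem_ball_zero_iff.2 (hx'.trans_lt hεη))
        have h2 : (P fun _ => ε • x) = ε ^ n * P fun _ => x := by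
          simpa using P.map_smul_univ (fun _ => ε) (fun _ => x)
        have h3 : δ < |P fun _ => x| := hball x (Metric.ball_subset_ball hrr₀ hx)
        rw [h2, norm_pow, norm_norm, Real.norm_eq_abs] at h1
        have h4 : C * ‖ε • x‖ ^ (n + 1) ≤ ε ^ n * (δ / 2) := by
          calc C * ‖ε • x‖ ^ (n + 1) ≤ C * (ε * R) ^ (n + 1) := by gcongr
            _ = ε ^ n * (ε * (C * R ^ (n + 1))) := by ring
            _ ≤ _ := by gcongr
        have h5 := abs_sub_abs_le_abs_sub (ε ^ n * P fun _ => x) (f (ε • x))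
        rw [abs_sub_comm, abs_mul, abs_of_nonneg (hf0 _), abs_of_pos (pow_pos hε n)] at h5
        have h6 := mul_le_mul_of_nonneg_left h3.le (pow_pos hε n).le
        linarith
      calc c * (ε ^ n / ε ^ (4 * m))
          = δ / 2 * ε ^ n / ((d * R ^ 2) ^ (2 * m) * ε ^ (4 * m)) := by
            rw [hc, div_mul_div_comm]
        _ ≤ f (ε • x) / disp d (ε • x) ^ m :=
            div_le_div₀ (hf0 _) hf (pow_pos hpos m) hdisp
    have hres : (torusMeasure d).restrict (Metric.ball (ε • v) (ε * r)) =
        volume.restrict (Metric.ball (ε • v) (ε * r)) := by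
      rw [torusMeasure, Measure.restrict_restrict measurableSet_ball,
        Set.inter_eq_left.2 hsub]
    have hintb : IntegrableOn (fun q => f q / disp d q ^ m) (Metric.ball (ε • v) (ε * r)) := by
      have := hint.integrableOn (s := Metric.ball (ε • v) (ε * r))
      rwa [IntegrableOn, hres] at this
    rw [hres]
    have hge := setIntegral_ge_of_const_le_real measurableSet_ball measure_ball_lt_top.ne
      hbound hintb
    refine le_trans ?_ hge
    rw [Measure.real, hvol ε hε, ENNReal.toReal_mul, ENNReal.toReal_ofReal (by positivity)]
    change c * V ≤ c * (ε ^ n / ε ^ (4 * m)) * (ε ^ d * V)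
    have h1 : 1 ≤ ε ^ n / ε ^ (4 * m) * ε ^ d := by
      rw [div_mul_eq_mul_div, ← pow_add, one_le_div (by positivity)]
      exact pow_le_pow_of_le_one hε.le hε1 hnm
    calc c * V = c * V * 1 := (mul_one _).symm
      _ ≤ c * V * (ε ^ n / ε ^ (4 * m) * ε ^ d) := by gcongr
      _ = _ := by ring
  have hshrink : Tendsto ((torusMeasure d) ∘ fun ε : ℝ => Metric.ball (ε • v) (ε * r)) (𝓝[>] 0)
      (𝓝 0) := by
    have h1 : Tendsto (fun ε : ℝ => ENNReal.ofReal (ε ^ d) *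
        volume (Metric.ball (0 : Fin d → ℝ) r)) (𝓝[>] 0) (𝓝 0) := by
      have h2 : Tendsto (fun ε : ℝ => ENNReal.ofReal (ε ^ d)) (𝓝 0) (𝓝 (ENNReal.ofReal (0 ^ d))) :=
        ENNReal.tendsto_ofReal ((continuous_pow d).tendsto 0)
      rw [zero_pow (by omega), ENNReal.ofReal_zero] at h2
      simpa using (ENNReal.Tendsto.mul_const h2 (Or.inr measure_ball_lt_top.ne)).mono_left
        nhdsWithin_le_nhds
    refine tendsto_of_tendsto_of_tendsto_of_le_of_le' tendsto_const_nhds h1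
      (Eventually.of_forall fun _ => zero_le) ?_
    filter_upwards [self_mem_nhdsWithin] with ε hε
    exact (Measure.restrict_apply_le _ _).trans (hvol ε hε).le
  have hlim := ge_of_tendsto (hint.tendsto_setIntegral_nhds_zero hshrink) hlower
  exact absurd hlim (not_le.2 (mul_pos hc0 hV0))

/-- For a nonnegative, even, real-analytic, not identically zero
2π-periodic function f with vanishing order 2n_o at the origin, the limit
lim_{z → 0⁻} ℓ_f(z) exists and is finite if and only if 2n_o + d ≥ 5; moreover, writing
ℓ_f(0) for this limit when it exists, the limit lim_{z → 0⁻} (ℓ_f(z) − ℓ_f(0))/z exists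
and is finite if and only if 2n_o + d ≥ 9, in which case it equals ∫ f(q)/𝔢(q)² dq. -/
theorem ell_continuity_and_differentiability_at_zero
    (d : ℕ) (hd : 1 ≤ d)
    (f : (Fin d → ℝ) → ℝ)
    (hf_per : ∀ (p : Fin d → ℝ) (k : Fin d → ℤ),
      f (fun i => p i + 2 * Real.pi * (k i : ℝ)) = f p)
    (hf_even : ∀ p, f (-p) = f p)
    (hf_nonneg : ∀ p, 0 ≤ f p)
    (hf_ne : f ≠ 0)
    (hf_analytic : AnalyticOnNhd ℝ f Set.univ)
    (nO : ℕ)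
    (hDzero : ∀ j : ℕ, j < 2 * nO → iteratedFDeriv ℝ j f 0 = 0)
    (hDne : iteratedFDeriv ℝ (2 * nO) f 0 ≠ 0) :
    ((∃ L : ℝ, Tendsto (ellInt d f) (𝓝[<] (0 : ℝ)) (𝓝 L)) ↔ 5 ≤ 2 * nO + d) ∧
    (∀ L : ℝ, Tendsto (ellInt d f) (𝓝[<] (0 : ℝ)) (𝓝 L) →
      ((∃ M : ℝ, Tendsto (fun z => (ellInt d f z - L) / z) (𝓝[<] (0 : ℝ)) (𝓝 M)) ↔
        9 ≤ 2 * nO + d) ∧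
      (9 ≤ 2 * nO + d →
        Tendsto (fun z => (ellInt d f z - L) / z) (𝓝[<] (0 : ℝ))
          (𝓝 (∫ q, f q / (disp d q) ^ 2 ∂(torusMeasure d))))) := by
  obtain ⟨P, hP, hPO⟩ := exists_leading_term (hf_analytic 0 trivial) hDzero hDne
  have hfc : Continuous f := continuousOn_univ.1 hf_analytic.continuousOn
  have hO : f =O[𝓝 0] fun y => ‖y‖ ^ (2 * nO) := by
    have h1 : (fun y : Fin d → ℝ => P fun _ => y) =O[𝓝 0] fun y => ‖y‖ ^ (2 * nO) :=
      Asymptotics.IsBigO.of_bound ‖P‖ (Eventually.of_forall fun y => by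
        simpa using P.le_opNorm fun _ => y)
    have h2 : (fun y : Fin d → ℝ => ‖y‖ ^ (2 * nO + 1)) =O[𝓝 0] fun y => ‖y‖ ^ (2 * nO) :=
      Asymptotics.IsBigO.of_bound 1 (by
        filter_upwards [Metric.ball_mem_nhds (0 : Fin d → ℝ) one_pos] with y hy
        rw [mem_ball_zero_iff] at hy
        simpa using pow_le_pow_of_le_one (norm_nonneg y) hy.le (Nat.le_succ (2 * nO)))
    simpa using (hPO.trans h2).add h1
  have hiff : ∀ m : ℕ, Integrable (fun q => f q / disp d q ^ m) (torusMeasure d) ↔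
      4 * m < 2 * nO + d := fun m =>
    ⟨lt_of_integrable_div_disp_pow hd hf_nonneg hP hPO, integrable_div_disp_pow hd hfc hO⟩
  have hiff1 : Integrable (fun q => f q / disp d q) (torusMeasure d) ↔ 5 ≤ 2 * nO + d := by
    simpa [Nat.lt_iff_add_one_le] using hiff 1
  have hiff2 : Integrable (fun q => f q / disp d q / disp d q) (torusMeasure d) ↔
      9 ≤ 2 * nO + d := by
    simpa [Nat.lt_iff_add_one_le, div_div, ← sq] using hiff 2
  have hfm := hfc.measurable
  have hem := (continuous_disp d).measurable
  have hne := ae_disp_ne_zero hd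
  have hconv : ∀ {L : ℝ}, Tendsto (ellInt d f) (𝓝[<] (0 : ℝ)) (𝓝 L) →
      Integrable (fun q => f q / disp d q) (torusMeasure d) := fun hL =>
    integrable_div_of_tendsto hfm hem hf_nonneg (disp_nonneg d) hne
      (integrable_of_continuous hfc) hL
  refine ⟨⟨fun ⟨L, hL⟩ => hiff1.1 (hconv hL), fun h => ⟨_, tendsto_integral_div_sub hfm hem
    hf_nonneg (disp_nonneg d) hne (hiff1.2 h)⟩⟩, fun L hL => ?_⟩
  have hint := hconv hL
  have hL' : L = ∫ q, f q / disp d q ∂(torusMeasure d) := tendsto_nhds_unique hL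
    (tendsto_integral_div_sub hfm hem hf_nonneg (disp_nonneg d) hne hint)
  have hg0 : ∀ q, 0 ≤ f q / disp d q := fun q => div_nonneg (hf_nonneg q) (disp_nonneg d q)
  have hgm : Measurable fun q => f q / disp d q := hfm.div hem
  have hquot : (fun z => (ellInt d f z - L) / z) =ᶠ[𝓝[<] (0 : ℝ)]
      fun z => ∫ q, f q / disp d q / (disp d q - z) ∂(torusMeasure d) := by
    filter_upwards [self_mem_nhdsWithin] with z hz
    have hz : z < 0 := hz
    have hintz : Integrable (fun q => f q / (disp d q - z)) (torusMeasure d) := by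
      refine hint.mono' (hfm.div (hem.sub_const z)).aestronglyMeasurable ?_
      filter_upwards [hne] with q hq
      have := disp_nonneg d q
      rw [Real.norm_of_nonneg (div_nonneg (hf_nonneg q) (by linarith))]
      exact div_le_div_of_nonneg_left (hf_nonneg q) (lt_of_le_of_ne this hq.symm) (by linarith)
    rw [ellInt, hL', ← integral_sub hintz hint, ← integral_div]
    refine integral_congr_ae ?_
    filter_upwards [hne] with q hq
    have h1 : disp d q - z ≠ 0 := by linarith [disp_nonneg d q]
    field_simp [hz.ne]
    ring
  simp only [tendsto_congr' hquot]
  have hlim : 9 ≤ 2 * nO + d → Tendsto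
      (fun z => ∫ q, f q / disp d q / (disp d q - z) ∂(torusMeasure d)) (𝓝[<] (0 : ℝ))
      (𝓝 (∫ q, f q / (disp d q) ^ 2 ∂(torusMeasure d))) := fun h => by
    simpa [div_div, ← sq] using
      tendsto_integral_div_sub hgm hem hg0 (disp_nonneg d) hne (hiff2.2 h)
  refine ⟨⟨fun ⟨M, hM⟩ => ?_, fun h => ⟨_, hlim h⟩⟩, hlim⟩
  exact hiff2.1 (integrable_div_of_tendsto hgm hem hg0 (disp_nonneg d) hne hint hM)
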